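/- A finite abstract cubical complex (V, ▢) admits an embedding into I^n (an injection f : V → (Fin n → Bool) such that for every face F ∈ ▢ the image f(F) is the vertex set of a face of I^n) if and only if the graph of (V, ▢) admits an embedding into the hypercube graph Q_n (an injective map of vertices sending adjacent vertices to adjacent vertices). -/

import Mathlib

/-- A face of the cube `I^n`: `none` marks a free coordinate. -/
def CubeFace (n : ℕ) : Type := Fin n → Option Bool

namespace CubeFace

/-- The order on faces of the cube: `F ≤ G` iff every coordinate of `G` is free
or agrees with the corresponding coordinate of `F`. -/
instance (n : ℕ) : PartialOrder (CubeFace n) where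
  le F G := ∀ i, G i = none ∨ F i = G i
  le_refl F i := Or.inr rfl
  le_trans F G H h1 h2 i := by
    rcases h2 i with h | h
    · exact Or.inl h
    · rcases h1 i with h' | h'
      · exact Or.inl (h ▸ h')
      · exact Or.inr (h' ▸ h)
  le_antisymm F G h1 h2 := by
    funext i
    rcases h1 i with h | h
    · rcases h2 i with h' | h'
      · rw [h, h']
      · rw [← h', h]
    · exact h

/-- The face of `I^n` corresponding to a vertex. -/
def toFace {n : ℕ} (v : Fin n → Bool) : CubeFace n := fun i => some (v i)

/-- The vertex set of a face. -/
def verts {n : ℕ} (F : CubeFace n) : Set (Fin n → Bool) := {v | toFace v ≤ F}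

/-- The dimension of a face: its number of free coordinates. -/
def dim {n : ℕ} (F : CubeFace n) : ℕ :=
  haveI : DecidablePred (fun i => F i = none) := fun i => Option.instDecidableEq (F i) none
  (Finset.univ.filter (fun i => F i = none)).card

/-- A subcomplex of `I^n`: a nonempty, downward closed set of faces. -/
def IsSubcomplex {n : ℕ} (K : Set (CubeFace n)) : Prop :=
  K.Nonempty ∧ ∀ F ∈ K, ∀ G : CubeFace n, G ≤ F → G ∈ K

/-- The vertex set of a subcomplex. -/
def cvert {n : ℕ} (K : Set (CubeFace n)) : Set (Fin n → Bool) := {v | toFace v ∈ K}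

/-- A subcomplex `Γ ⊆ K` is face-like if, for every face `F` of `K`, the set of vertices
of `F` belonging to `Γ` is empty or the vertex set of a face of `Γ`. -/
def FaceLike {n : ℕ} (K Γ : Set (CubeFace n)) : Prop :=
  ∀ F ∈ K, verts F ∩ cvert Γ = ∅ ∨ ∃ G ∈ Γ, verts F ∩ cvert Γ = verts G

/-- The deletion `K ∖ Γ`: the faces of `K` with no vertex in `Γ`. -/
def delete {n : ℕ} (K Γ : Set (CubeFace n)) : Set (CubeFace n) :=
  {F | F ∈ K ∧ verts F ∩ cvert Γ = ∅}

/-- The geometric realization of a subcomplex of `I^n`, as a subset of `ℝ^n`. -/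
def real {n : ℕ} (K : Set (CubeFace n)) : Set (Fin n → ℝ) :=
  ⋃ F ∈ K, {x | (∀ i, 0 ≤ x i ∧ x i ≤ 1) ∧
    ∀ i, (F i = some false → x i = 0) ∧ (F i = some true → x i = 1)}

/-- The boundary `∂F̂` of a face `F`: all faces strictly below `F`. -/
def bdryHat {n : ℕ} (F : CubeFace n) : Set (CubeFace n) := {G | G ≤ F ∧ G ≠ F}

/-- The boundary of the cube `I^k`: all faces except the top one. -/
def boundaryCube (k : ℕ) : Set (CubeFace k) := {F | F ≠ fun _ => none}

/-- The `k`-skeleton of a subcomplex. -/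
def skel {n : ℕ} (k : ℕ) (K : Set (CubeFace n)) : Set (CubeFace n) :=
  {F | F ∈ K ∧ dim F ≤ k}

/-- Isomorphism of cubical subcomplexes: a bijection between the vertex sets under which
vertex sets of faces correspond to vertex sets of faces. -/
def Iso {m n : ℕ} (K : Set (CubeFace m)) (L : Set (CubeFace n)) : Prop :=
  ∃ f : (Fin m → Bool) → (Fin n → Bool),
    Set.BijOn f (cvert K) (cvert L) ∧
    ∀ W : Set (Fin m → Bool), W ⊆ cvert K →
      ((∃ F ∈ K, verts F = W) ↔ (∃ G ∈ L, verts G = f '' W))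

/-- `K` has dimension `d`. -/
def HasDim {n : ℕ} (K : Set (CubeFace n)) (d : ℕ) : Prop :=
  (∀ F ∈ K, dim F ≤ d) ∧ ∃ F ∈ K, dim F = d

end CubeFace

namespace CubeFace

/-- Flip the `j`-th coordinate. -/
def flipAt {k : ℕ} (w : Fin k → Bool) (j : Fin k) : Fin k → Bool :=
  fun i => w i ^^ decide (i = j)

lemma flipAt_ne {k : ℕ} (w : Fin k → Bool) (j : Fin k) : flipAt w j ≠ w := by
  intro h
  have := congrFun h j
  simp [flipAt] at this

/-- The vertex of the cube indicated by a finite set. -/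
def indic {k : ℕ} (S : Finset (Fin k)) : Fin k → Bool := fun i => decide (i ∈ S)

lemma indic_insert {k : ℕ} (S : Finset (Fin k)) (a : Fin k) (ha : a ∉ S) :
    indic (insert a S) = flipAt (indic S) a := by
  funext i
  by_cases h : i = a
  · subst h; simp [indic, flipAt, ha]
  · simp [indic, flipAt, h]

/-- An injective edge-preserving map of hypercubes has a face as its image. -/
lemma range_is_face {k n : ℕ} (p : (Fin k → Bool) → (Fin n → Bool))
    (hp : Function.Injective p)
    (hadj : ∀ w j, (Finset.univ.filter (fun i => p w i ≠ p (flipAt w j) i)).card = 1) :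
    ∃ Q : CubeFace n, Set.range p = verts Q := by
  have h1 : ∀ w j, ∃ d, ∀ i, p (flipAt w j) i = (p w i ^^ decide (i = d)) := by
    intro w j
    obtain ⟨d, hd⟩ := Finset.card_eq_one.mp (hadj w j)
    refine ⟨d, fun i => ?_⟩
    have hi : p w i ≠ p (flipAt w j) i ↔ i = d := by
      have := Finset.ext_iff.mp hd i
      simpa using this
    by_cases h : i = d
    · have := hi.mpr h
      simp only [h, decide_true] at this ⊢
      revert this
      cases p w d <;> cases p (flipAt w j) d <;> simp
    · have := mt hi.mp h
      simp only [ne_eq, not_not] at this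
      simp [h, this]
  choose D hD using h1
  -- squares go to squares
  have hne : ∀ w l j, l ≠ j → D w l ≠ D w j := by
    intro w l j hlj h
    have : p (flipAt w l) = p (flipAt w j) := by
      funext i; rw [hD, hD, h]
    have := congrFun (hp this) l
    simp [flipAt, hlj] at this
  have hsq : ∀ w l j, l ≠ j → D (flipAt w l) j = D w j := by
    intro w l j hlj
    have hcomm : flipAt (flipAt w l) j = flipAt (flipAt w j) l := by
      funext i; simp only [flipAt, Bool.xor_assoc]; rw [Bool.xor_comm (decide (i = l))]
    have hab := hne w l j hlj
    have ha : D w l ≠ D (flipAt w l) j := by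
      intro h
      have : p (flipAt (flipAt w l) j) = p w := by
        funext i; rw [hD, hD, ← h]; simp
      have := congrFun (hp this) l
      simp [flipAt, hlj] at this
    have key : ∀ i, (decide (i = D w l) ^^ decide (i = D (flipAt w l) j))
        = (decide (i = D w j) ^^ decide (i = D (flipAt w j) l)) := by
      intro i
      have := congrFun (congrArg p hcomm) i
      rw [hD, hD, hD, hD] at this
      simpa [Bool.xor_assoc] using this
    have k1 := key (D w l)
    have k2 := key (D (flipAt w l) j)
    simp only [decide_true, ha, ha.symm, hab, decide_false] at k1 k2
    simp at k1 k2
    grind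
  have hmain : ∀ S : Finset (Fin k), (∀ j, j ∉ S → D (indic S) j = D (indic ∅) j) ∧
      ∀ i, p (indic S) i = (p (indic ∅) i ^^ decide (∃ j ∈ S, D (indic ∅) j = i)) := by
    intro S
    induction S using Finset.induction_on with
    | empty => simp
    | insert a S ha ih =>
      obtain ⟨ih1, ih2⟩ := ih
      rw [indic_insert S a ha]
      constructor
      · intro j hj
        simp only [Finset.mem_insert, not_or] at hj
        rw [hsq _ _ _ (Ne.symm hj.1), ih1 j hj.2]
      · intro i
        rw [hD, ih2, ih1 a ha, Bool.xor_assoc]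
        congr 1
        by_cases h : i = D (indic ∅) a
        · subst h
          have : ¬ ∃ j ∈ S, D (indic ∅) j = D (indic ∅) a := by
            rintro ⟨j, hj, hja⟩
            exact hne (indic ∅) j a (fun h => ha (h ▸ hj)) hja
          simp [this]
        · have h' : D (indic ∅) a ≠ i := fun e => h e.symm
          simp [h, h']
  classical
  refine ⟨fun i => if ∃ j, D (indic ∅) j = i then none else some (p (indic ∅) i), ?_⟩
  ext v
  constructor
  · rintro ⟨w, rfl⟩ i
    have hw : w = indic (Finset.univ.filter (fun j => w j = true)) := by
      funext j; simp [indic]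
    by_cases h : ∃ j, D (indic ∅) j = i
    · left; simp only [if_pos h]
    · right
      simp only [if_neg h, toFace]
      rw [hw, (hmain _).2]
      have : ¬ ∃ j ∈ Finset.univ.filter (fun j => w j = true), D (indic ∅) j = i := by
        rintro ⟨j, -, hj⟩; exact h ⟨j, hj⟩
      simp only [this, decide_false, Bool.xor_false]
  · intro hv
    refine ⟨indic (Finset.univ.filter
      (fun j => v (D (indic ∅) j) ≠ p (indic ∅) (D (indic ∅) j))), ?_⟩
    funext i
    rw [(hmain _).2]
    by_cases h : v i = p (indic ∅) i
    · have : ¬ ∃ j ∈ Finset.univ.filter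
          (fun j => v (D (indic ∅) j) ≠ p (indic ∅) (D (indic ∅) j)), D (indic ∅) j = i := by
        rintro ⟨j, hj, rfl⟩
        simp [h] at hj
      simp only [this, decide_false, Bool.xor_false, h]
    · have : ∃ j ∈ Finset.univ.filter
          (fun j => v (D (indic ∅) j) ≠ p (indic ∅) (D (indic ∅) j)), D (indic ∅) j = i := by
        rcases hv i with h2 | h2
        · by_cases h3 : ∃ j, D (indic ∅) j = i
          · obtain ⟨j, rfl⟩ := h3
            exact ⟨j, by simpa using h, rfl⟩
          · simp [h3] at h2
        · by_cases h3 : ∃ j, D (indic ∅) j = i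
          · obtain ⟨j, rfl⟩ := h3
            exact ⟨j, by simpa using h, rfl⟩
          · simp [h3, toFace] at h2
            exact absurd h2 h
      simp only [this, decide_true, Bool.xor_true]
      revert h
      cases v i <;> cases p (indic ∅) i <;> simp

lemma eq_toFace_of_le {k : ℕ} {w : Fin k → Bool} {G : CubeFace k} (h : G ≤ toFace w) :
    G = toFace w := by
  funext i
  rcases h i with h | h
  · simp [toFace] at h
  · exact h

lemma exists_toFace_le {k : ℕ} (M : CubeFace k) : ∃ w, toFace w ≤ M := by
  refine ⟨fun i => (M i).getD false, fun i => ?_⟩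
  simp only [toFace]
  cases M i <;> simp

lemma toFace_inj {k : ℕ} {w w' : Fin k → Bool} (h : toFace w = toFace w') : w = w' := by
  funext i
  have := congrFun h i
  simpa [toFace] using this

/-- The edge in direction `j` through `w`. -/
def edge {k : ℕ} (w : Fin k → Bool) (j : Fin k) : CubeFace k :=
  fun i => if i = j then none else some (w i)

lemma le_edge {k : ℕ} (w u : Fin k → Bool) (j : Fin k) :
    toFace u ≤ edge w j ↔ u = w ∨ u = flipAt w j := by
  constructor
  · intro h
    have h' : ∀ i, i ≠ j → u i = w i := by
      intro i hi
      have := h i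
      simpa [edge, toFace, hi] using this
    by_cases hj : u j = w j
    · left; funext i
      by_cases hi : i = j
      · rw [hi, hj]
      · exact h' i hi
    · right; funext i
      by_cases hi : i = j
      · subst hi
        simp only [flipAt, decide_true]
        revert hj
        cases u i <;> cases w i <;> simp
      · simp [flipAt, hi, h' i hi]
  · rintro (rfl | rfl) i <;> by_cases hi : i = j <;> simp [edge, toFace, flipAt, hi]

end CubeFace

open CubeFace in
/-- A finite abstract cubical complex `(V, C)` embeds into `I^n` iff its
graph embeds into the hypercube graph `Q_n`. -/
theorem cubical_complex_embeds_iff_graph_embeds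
    {V : Type} [Fintype V] [DecidableEq V] (C : Set (Finset V))
    (hempty : ∅ ∉ C)
    (hsingle : ∀ v : V, ({v} : Finset V) ∈ C)
    (hposet : ∀ F ∈ C, ∃ k : ℕ,
      Nonempty ({G : Finset V // G ∈ C ∧ G ⊆ F} ≃o CubeFace k))
    (hinter : ∀ F ∈ C, ∀ G ∈ C, F ∩ G = ∅ ∨ F ∩ G ∈ C)
    (n : ℕ) :
    (∃ f : V → (Fin n → Bool), Function.Injective f ∧
        ∀ F ∈ C, ∃ Q : CubeFace n, f '' (F : Set V) = verts Q) ↔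
    (∃ g : V → (Fin n → Bool), Function.Injective g ∧
        ∀ u v : V, u ≠ v → ({u, v} : Finset V) ∈ C →
          (Finset.univ.filter (fun i => g u i ≠ g v i)).card = 1) := by
  constructor
  · rintro ⟨f, hf, hF⟩
    refine ⟨f, hf, fun u v huv hC => ?_⟩
    obtain ⟨Q, hQ⟩ := hF _ hC
    have hu : f u ∈ verts Q := by rw [← hQ]; exact ⟨u, by simp, rfl⟩
    have hv : f v ∈ verts Q := by rw [← hQ]; exact ⟨v, by simp, rfl⟩
    have hfne : f u ≠ f v := fun h => huv (hf h)
    obtain ⟨i, hi⟩ := Function.ne_iff.mp hfne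
    rw [Finset.card_eq_one]
    refine ⟨i, ?_⟩
    have hmem : Function.update (f u) i (f v i) ∈ verts Q := by
      intro l
      by_cases hl : l = i
      · subst hl
        have := hv l
        simpa [toFace] using this
      · have := hu l
        simpa [toFace, hl] using this
    rw [← hQ] at hmem
    obtain ⟨x, hx, hxe⟩ := hmem
    have hx' : x = u ∨ x = v := by simpa using hx
    rcases hx' with rfl | rfl
    · have := congrFun hxe i
      simp at this
      exact absurd this hi
    · ext l
      simp only [Finset.mem_filter, Finset.mem_univ, true_and, Finset.mem_singleton]
      constructor
      · intro h
        by_contra hl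
        have := congrFun hxe l
        simp [hl] at this
        exact h this.symm
      · rintro rfl; exact hi
  · rintro ⟨g, hg, hadj⟩
    refine ⟨g, hg, fun F hFC => ?_⟩
    obtain ⟨k, ⟨φ⟩⟩ := hposet F hFC
    have hh : ∀ w : Fin k → Bool, ∃ v, (φ.symm (toFace w)).1 = {v} := by
      intro w
      have hne : (φ.symm (toFace w)).1.Nonempty := by
        rw [Finset.nonempty_iff_ne_empty]
        intro h
        exact hempty (h ▸ (φ.symm (toFace w)).2.1)
      obtain ⟨v, hv⟩ := hne
      have hvF : v ∈ F := (φ.symm (toFace w)).2.2 hv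
      let G : {G : Finset V // G ∈ C ∧ G ⊆ F} := ⟨{v}, hsingle v, by simpa using hvF⟩
      have hle : G ≤ φ.symm (toFace w) := by
        show ({v} : Finset V) ⊆ _
        simpa using hv
      have h2 : φ G ≤ toFace w := by
        rw [← φ.apply_symm_apply (toFace w)]; exact φ.monotone hle
      have h3 := eq_toFace_of_le h2
      refine ⟨v, ?_⟩
      rw [← h3, φ.symm_apply_apply]
    choose h hh using hh
    have hhF : ∀ w, h w ∈ F := fun w =>
      (φ.symm (toFace w)).2.2 (by rw [hh]; simp)
    have hmem : ∀ w (E : CubeFace k), h w ∈ (φ.symm E).1 ↔ toFace w ≤ E := by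
      intro w E
      rw [← φ.symm.le_iff_le]
      show _ ↔ (φ.symm (toFace w)).1 ⊆ (φ.symm E).1
      rw [hh]; simp
    have hinj : Function.Injective h := by
      intro w w' e
      apply toFace_inj
      apply φ.symm.injective
      apply Subtype.ext
      rw [hh, hh, e]
    have hsurj : ∀ v ∈ F, ∃ w, h w = v := by
      intro v hv
      let G : {G : Finset V // G ∈ C ∧ G ⊆ F} := ⟨{v}, hsingle v, by simpa using hv⟩
      obtain ⟨w, hw⟩ := exists_toFace_le (φ G)
      refine ⟨w, ?_⟩
      have := (hmem w (φ G)).mpr hw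
      rw [φ.symm_apply_apply] at this
      simpa [G] using this
    have hedge : ∀ w j, ({h w, h (flipAt w j)} : Finset V) ∈ C := by
      intro w j
      have : (φ.symm (edge w j)).1 = {h w, h (flipAt w j)} := by
        ext x
        simp only [Finset.mem_insert, Finset.mem_singleton]
        constructor
        · intro hx
          obtain ⟨u, rfl⟩ := hsurj x ((φ.symm (edge w j)).2.2 hx)
          rw [hmem, le_edge] at hx
          rcases hx with rfl | rfl <;> simp
        · rintro (rfl | rfl) <;> rw [hmem, le_edge] <;> simp
      rw [← this]
      exact (φ.symm (edge w j)).2.1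
    obtain ⟨Q, hQ⟩ := range_is_face (fun w => g (h w)) (hg.comp hinj) (fun w j =>
      hadj _ _ (fun e => flipAt_ne w j (hinj e).symm) (hedge w j))
    refine ⟨Q, ?_⟩
    rw [← hQ]
    ext y
    constructor
    · rintro ⟨v, hv, rfl⟩
      obtain ⟨w, rfl⟩ := hsurj v hv
      exact ⟨w, rfl⟩
    · rintro ⟨w, rfl⟩
      exact ⟨h w, hhF w, rfl⟩
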